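/- arXiv:2207.08873 — 6 statements merged into one kernel-verified Lean document; each statement's English description precedes it below -/
import Mathlib

section
/- For every u ∈ ℝ^n, the supremum over p in the simplex Δ of ⟨p,u⟩ + 1 − σ_k(p) is attained and equals max over m ∈ {1,…,n} of ( σ_m(u)/m + max(0, 1 − k/m) ). Consequently the surrogate defined by L_k(u,y) = sup_{p∈Δ}(⟨p,u⟩ + 1 − σ_k(p)) − u_y satisfies L_k(u,y) = max_{1≤m≤n} ( σ_m(u)/m + max(0, 1 − k/m) ) − u_y, a pointwise maximum of finitely many affine functions of u. -/
open scoped NNReal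

def simplex (n : ℕ) : Set (Fin n → ℝ) := {p | (∀ i, 0 ≤ p i) ∧ ∑ i, p i = 1}

noncomputable def sigmaTop (n m : ℕ) (u : Fin n → ℝ) : ℝ :=
  if h : ((Finset.univ : Finset (Fin n)).powersetCard m).Nonempty then
    ((Finset.univ : Finset (Fin n)).powersetCard m).sup' h (fun S => ∑ i ∈ S, u i)
  else 0

noncomputable def Lk (n k : ℕ) (u : Fin n → ℝ) (y : Fin n) : ℝ :=
  if h : (Finset.Icc 1 n).Nonempty then
    (Finset.Icc 1 n).sup' h
      (fun m => sigmaTop n m u / (m : ℝ) + max 0 (1 - (k : ℝ) / (m : ℝ))) - u y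
  else 0

def indic {n : ℕ} (S : Finset (Fin n)) : Fin n → ℝ := fun i => if i ∈ S then 1 else 0

noncomputable def nthLarge {n : ℕ} (v : Fin n → ℝ) (j : ℕ) : ℝ :=
  if h : n - j < n then v (Tuple.sort v ⟨n - j, h⟩) else 0

noncomputable def L2 (n k : ℕ) (u : Fin n → ℝ) (y : Fin n) : ℝ :=
  max 0 (1 - u y + (1 / (k : ℝ)) * sigmaTop n k (u - Pi.single y 1))

noncomputable def L3 (n k : ℕ) (u : Fin n → ℝ) (y : Fin n) : ℝ :=
  (1 / (k : ℝ)) * ∑ i ∈ Finset.Icc 1 k, max 0 (1 - u y + nthLarge (u - Pi.single y 1) i)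

noncomputable def sigmaExcl (n k : ℕ) (u : Fin n → ℝ) (y : Fin n) : ℝ :=
  if h : ((Finset.univ.erase y).powersetCard k).Nonempty then
    ((Finset.univ.erase y).powersetCard k).sup' h (fun S => ∑ i ∈ S, u i)
  else 0

noncomputable def L4 (n k : ℕ) (u : Fin n → ℝ) (y : Fin n) : ℝ :=
  max 0 (1 - u y + (1 / (k : ℝ)) * sigmaExcl n k u y)

noncomputable def ell2 (k : ℕ) {n : ℕ} (H M : Finset (Fin n)) (y : Fin n) : ℝ :=
  if y ∈ H then 0
  else if y ∈ M then ((H.card : ℝ) + M.card - 1) / ((k : ℝ) - H.card)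
  else ((H.card : ℝ) + M.card - 1) / ((k : ℝ) - H.card) + ((k : ℝ) + 1) / k

noncomputable def ell4 (k : ℕ) {n : ℕ} (T : Finset (Fin n)) (y : Fin n) : ℝ :=
  if y ∈ T then 0 else ((k : ℝ) + 1) / ((k : ℝ) + 1 - T.card)


lemma sum_le_sigmaTop {n : ℕ} (u : Fin n → ℝ) (S : Finset (Fin n)) :
    ∑ i ∈ S, u i ≤ sigmaTop n S.card u := by
  have hS : S ∈ (Finset.univ : Finset (Fin n)).powersetCard S.card := by
    simp [Finset.mem_powersetCard]
  unfold sigmaTop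
  rw [dif_pos ⟨S, hS⟩]
  exact Finset.le_sup' (fun S => ∑ i ∈ S, u i) hS

lemma exists_sigmaTop_eq_sum {n m : ℕ} (hm : m ≤ n) (u : Fin n → ℝ) :
    ∃ S : Finset (Fin n), S.card = m ∧ sigmaTop n m u = ∑ i ∈ S, u i := by
  have hne : ((Finset.univ : Finset (Fin n)).powersetCard m).Nonempty := by
    simpa [Finset.powersetCard_nonempty] using hm
  obtain ⟨S, hS, h⟩ := Finset.exists_mem_eq_sup' hne (fun S => ∑ i ∈ S, u i)
  refine ⟨S, (Finset.mem_powersetCard.mp hS).2, ?_⟩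
  unfold sigmaTop
  rw [dif_pos hne, h]

/-- A set of fixed size whose sum is maximal consists of largest entries. -/
lemma le_of_sum_eq_sigmaTop {n : ℕ} {q : Fin n → ℝ} {T : Finset (Fin n)}
    (hT : sigmaTop n T.card q = ∑ i ∈ T, q i) {i j : Fin n} (hi : i ∈ T) (hj : j ∉ T) :
    q j ≤ q i := by
  have hj' : j ∉ T.erase i := fun h => hj (Finset.mem_of_mem_erase h)
  have hcard : (insert j (T.erase i)).card = T.card := by
    rw [Finset.card_insert_of_notMem hj', Finset.card_erase_add_one hi]
  have h := sum_le_sigmaTop q (insert j (T.erase i))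
  rw [hcard, hT, Finset.sum_insert hj', ← Finset.add_sum_erase T q hi] at h
  linarith

/-- A nonnegative function integrates nonpositively against a signed weight as soon as all its
superlevel sets have nonpositive weight. -/
lemma sum_mul_nonpos_of_superlevel {ι : Type*} [Fintype ι] (w q : ι → ℝ) (hq : ∀ i, 0 ≤ q i)
    (h : ∀ c : ℝ, 0 < c → ∑ i with c ≤ q i, w i ≤ 0) : ∑ i, q i * w i ≤ 0 := by
  induction hN : (Finset.univ.filter fun i => 0 < q i).card using Nat.strong_induction_on
    generalizing q with
  | _ N ih =>
    rcases (Finset.univ.filter fun i => 0 < q i).eq_empty_or_nonempty with hS | hS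
    · have hz : ∀ i, q i = 0 := fun i =>
        le_antisymm (not_lt.mp fun hi => by simpa [hi] using Finset.ext_iff.mp hS i) (hq i)
      simp [hz]
    · obtain ⟨a, ha, hmin⟩ := Finset.exists_min_image _ q hS
      have ha0 : 0 < q a := by simpa using ha
      have hcut : ∀ i, 0 < q i → q a ≤ q i := fun i hi => hmin i (by simpa using hi)
      let r : ι → ℝ := fun i => max 0 (q i - q a)
      have hr : ∑ i, r i * w i ≤ 0 := by
        refine ih _ ?_ r (fun i => le_max_left _ _) ?_ rfl
        · rw [← hN]
          refine Finset.card_lt_card (Finset.ssubset_iff_subset_ne.mpr ⟨fun i hi => ?_, fun he => ?_⟩)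
          · have : q a < q i := by simpa [r] using hi
            simpa using ha0.trans this
          · rw [← he] at ha
            simp [r] at ha
        · intro c hc
          have : (Finset.univ.filter fun i => c ≤ r i) =
              Finset.univ.filter fun i => c + q a ≤ q i := by
            ext i
            simp [r, hc.not_ge, le_sub_iff_add_le]
          rw [this]
          exact h _ (by linarith)
      have hsplit : ∑ i, q i * w i = ∑ i, r i * w i + q a * ∑ i with q a ≤ q i, w i := by
        rw [Finset.mul_sum, Finset.sum_filter, ← Finset.sum_add_distrib]
        refine Finset.sum_congr rfl fun i _ => ?_
        by_cases hi : q a ≤ q i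
        · simp only [r, if_pos hi, max_eq_right (sub_nonneg.mpr hi)]
          ring
        · have hi0 : q i = 0 := le_antisymm (not_lt.mp fun h0 => hi (hcut i h0)) (hq i)
          simp [r, hi0, ha0.le, ha0.not_ge]
      rw [hsplit]
      have := mul_nonpos_of_nonneg_of_nonpos ha0.le (h _ ha0)
      linarith

lemma objective_le_of_bound {n k : ℕ} (hkn : k ≤ n) (u : Fin n → ℝ) (M : ℝ)
    (hM : ∀ m ∈ Finset.Icc 1 n, sigmaTop n m u / (m : ℝ) + max 0 (1 - (k : ℝ) / (m : ℝ)) ≤ M)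
    {q : Fin n → ℝ} (hq : q ∈ simplex n) :
    (∑ i, q i * u i) + 1 - sigmaTop n k q ≤ M := by
  obtain ⟨T, rfl, hT⟩ := exists_sigmaTop_eq_sum hkn q
  have key := sum_mul_nonpos_of_superlevel (fun i => u i + 1 - M - if i ∈ T then 1 else 0) q hq.1
    (fun c hc => by
      set S := Finset.univ.filter fun i => c ≤ q i with hSdef
      have hsum : ∑ i ∈ S, (u i + 1 - M - if i ∈ T then (1 : ℝ) else 0)
          = ∑ i ∈ S, u i + S.card * (1 - M) - (S ∩ T).card := by
        simp only [add_sub_assoc, Finset.sum_add_distrib, Finset.sum_sub_distrib, Finset.sum_const,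
          Finset.sum_ite_mem, nsmul_eq_mul]
        ring
      rw [hsum]
      rcases S.eq_empty_or_nonempty with hS | hS
      · simp [hS]
      have hm : (0 : ℝ) < S.card := by exact_mod_cast hS.card_pos
      have hMS := hM S.card (Finset.mem_Icc.mpr
        ⟨hS.card_pos, by simpa using Finset.card_le_univ S⟩)
      have hu := sum_le_sigmaTop u S
      have hcancel : (S.card : ℝ) * (sigmaTop n S.card u / S.card) = sigmaTop n S.card u := by
        field_simp
      by_cases hST : S ⊆ T
      · rw [Finset.inter_eq_left.mpr hST]
        have h0 : sigmaTop n S.card u / S.card ≤ M :=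
          (le_add_of_nonneg_right (le_max_left _ _)).trans hMS
        nlinarith [mul_le_mul_of_nonneg_left h0 hm.le]
      · obtain ⟨j, hjS, hjT⟩ := Finset.not_subset.mp hST
        have hTS : T ⊆ S := fun i hi => by
          have := le_of_sum_eq_sigmaTop hT hi hjT
          simp only [hSdef, Finset.mem_filter, Finset.mem_univ, true_and] at hjS ⊢
          linarith
        rw [Finset.inter_eq_right.mpr hTS]
        have h1 : sigmaTop n S.card u / S.card + (1 - (T.card : ℝ) / S.card) ≤ M :=
          (add_le_add_right (le_max_right _ _) _).trans hMS
        have hcancel' : (S.card : ℝ) * ((T.card : ℝ) / S.card) = T.card := by field_simp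
        nlinarith [mul_le_mul_of_nonneg_left h1 hm.le])
  have hexp : ∑ i, q i * (u i + 1 - M - if i ∈ T then 1 else 0)
      = ∑ i, q i * u i + (1 - M) * ∑ i, q i - ∑ i ∈ T, q i := by
    have : ∑ i ∈ T, q i = ∑ i, q i * if i ∈ T then 1 else 0 := by simp
    rw [this, Finset.mul_sum, ← Finset.sum_add_distrib, ← Finset.sum_sub_distrib]
    exact Finset.sum_congr rfl fun i _ => by ring
  rw [hexp, hq.2] at key
  rw [hT]
  linarith

/-- The uniform distribution on the top `m` labels realizes the `m`-th affine piece. -/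
lemma exists_mem_simplex_objective_ge {n k m : ℕ} (hkn : k ≤ n) (u : Fin n → ℝ)
    (hm : m ∈ Finset.Icc 1 n) :
    ∃ p ∈ simplex n, sigmaTop n m u / (m : ℝ) + max 0 (1 - (k : ℝ) / (m : ℝ))
      ≤ (∑ i, p i * u i) + 1 - sigmaTop n k p := by
  obtain ⟨hm1, hmn⟩ := Finset.mem_Icc.mp hm
  obtain ⟨S, rfl, hS⟩ := exists_sigmaTop_eq_sum hmn u
  have hm0 : (0 : ℝ) < S.card := by exact_mod_cast hm1
  refine ⟨fun i => if i ∈ S then (S.card : ℝ)⁻¹ else 0, ⟨fun i => ?_, ?_⟩, ?_⟩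
  · dsimp only
    split_ifs <;> positivity
  · simp [hm0.ne']
  · obtain ⟨T, rfl, hT⟩ := exists_sigmaTop_eq_sum hkn fun i => if i ∈ S then (S.card : ℝ)⁻¹ else 0
    have hin : ∑ i, (if i ∈ S then (S.card : ℝ)⁻¹ else 0) * u i = (∑ i ∈ S, u i) / S.card := by
      simp [ite_mul, Finset.sum_ite_mem, div_eq_inv_mul, Finset.mul_sum]
    have htop : ∑ i ∈ T, (if i ∈ S then (S.card : ℝ)⁻¹ else 0) = (T ∩ S).card / S.card := by
      simp [Finset.sum_ite_mem, div_eq_mul_inv]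
    have h1 : ((T ∩ S).card : ℝ) / S.card ≤ 1 := by
      rw [div_le_one hm0]
      exact_mod_cast Finset.card_le_card Finset.inter_subset_right
    have h2 : ((T ∩ S).card : ℝ) / S.card ≤ T.card / S.card := by
      gcongr
      exact Finset.inter_subset_left
    rw [hS, hT, hin, htop]
    have := max_le (sub_nonneg.mpr h1) (sub_le_sub_left h2 1)
    linarith

theorem stmt0 (n k : ℕ) (hk : 1 ≤ k) (hkn : k < n) (u : Fin n → ℝ) :
    (∃ p ∈ simplex n,
      (∀ q ∈ simplex n,
        (∑ i, q i * u i) + 1 - sigmaTop n k q ≤ (∑ i, p i * u i) + 1 - sigmaTop n k p) ∧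
      (∑ i, p i * u i) + 1 - sigmaTop n k p =
        (Finset.Icc 1 n).sup' ⟨1, Finset.mem_Icc.mpr ⟨le_rfl, by omega⟩⟩
          (fun m => sigmaTop n m u / (m : ℝ) + max 0 (1 - (k : ℝ) / (m : ℝ)))) ∧
    ∀ y : Fin n,
      sSup ((fun q => (∑ i, q i * u i) + 1 - sigmaTop n k q) '' simplex n) - u y
        = (Finset.Icc 1 n).sup' ⟨1, Finset.mem_Icc.mpr ⟨le_rfl, by omega⟩⟩
            (fun m => sigmaTop n m u / (m : ℝ) + max 0 (1 - (k : ℝ) / (m : ℝ))) - u y := by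
  have hne : (Finset.Icc 1 n).Nonempty := ⟨1, Finset.mem_Icc.mpr ⟨le_rfl, by omega⟩⟩
  obtain ⟨m, hm, hmax⟩ := Finset.exists_mem_eq_sup' hne
    (fun m => sigmaTop n m u / (m : ℝ) + max 0 (1 - (k : ℝ) / (m : ℝ)))
  obtain ⟨p, hp, hge⟩ := exists_mem_simplex_objective_ge hkn.le u hm
  have hle := fun q (hq : q ∈ simplex n) => objective_le_of_bound hkn.le u ((Finset.Icc 1 n).sup' hne
    fun m => sigmaTop n m u / (m : ℝ) + max 0 (1 - (k : ℝ) / (m : ℝ)))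
    (fun m hm => Finset.le_sup'
      (fun m => sigmaTop n m u / (m : ℝ) + max 0 (1 - (k : ℝ) / (m : ℝ))) hm) hq
  have heq := le_antisymm (hle p hp) (hmax.trans_le hge)
  refine ⟨⟨p, hp, fun q hq => (hle q hq).trans_eq heq.symm, heq⟩, fun y => ?_⟩
  congr 1
  refine IsGreatest.csSup_eq ⟨⟨p, hp, heq⟩, ?_⟩
  rintro _ ⟨q, hq, rfl⟩
  exact hle q hq
end

section
/- Let L : ℝ^d × Y → ℝ≥0 be a polyhedral loss (for each y, u ↦ L(u,y) is a pointwise maximum of finitely many affine functions) such that for every p ∈ Δ the expected loss u ↦ Σ_y p_y L(u,y) attains its infimum over ℝ^d. Let R̂ and R be finite nonempty sets, ℓ̂ : R̂ × Y → ℝ≥0 and ℓ : R × Y → ℝ≥0 discrete losses, and P ⊆ Δ. Write γ̂(p) for the set of minimizers of r ↦ Σ_y p_y ℓ̂(r,y) over R̂ and γ(p) for the set of minimizers of r ↦ Σ_y p_y ℓ(r,y) over R. Suppose L embeds ℓ̂: there is a set S ⊆ R̂ with S ∩ γ̂(p) ≠ ∅ for every p ∈ Δ, and an injection φ : S → ℝ^d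 such that L(φ(r),y) = ℓ̂(r,y) for all r ∈ S and y ∈ Y, and for all p ∈ Δ and r ∈ S, r ∈ γ̂(p) if and only if φ(r) minimizes u ↦ Σ_y p_y L(u,y) over ℝ^d. Suppose further that for every r̂ ∈ R̂ there exists r ∈ R such that {p ∈ P : r̂ ∈ γ̂(p)} ⊆ {p ∈ P : r ∈ γ(p)}. Then there exists a link function ψ : ℝ^d → R such that (L, ψ) is calibrated with respect to ℓ on P: for every p ∈ P there exists ε > 0 such that every u ∈ ℝ^d with ψ(u) ∉ γ(p) satisfies Σ_y p_y L(u,y) ≥ ε + inf_{u'∈ℝ^d} Σ_y p_y L(u',y). -/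
open scoped NNReal

/-- A minimax principle: if every probability vector `p` admits some `r` with `⟨p, f r⟩ ≤ ⟨p, v⟩`,
then a single convex combination of the `f r` lies below `v`. -/
theorem exists_mem_stdSimplex_sum_mul_le {ι κ : Type*} [Fintype ι] [Fintype κ] [Nonempty κ]
    (f : κ → ι → ℝ) (v : ι → ℝ)
    (h : ∀ p ∈ stdSimplex ℝ ι, ∃ r, ∑ y, p y * f r y ≤ ∑ y, p y * v y) :
    ∃ w ∈ stdSimplex ℝ κ, ∀ y, ∑ r, w r * f r y ≤ v y := by
  classical
  by_contra! hcon
  let T : (κ → ℝ) →ₗ[ℝ] (ι → ℝ) := Fintype.linearCombination ℝ f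
  have hT (w : κ → ℝ) (y : ι) : T w y = ∑ r, w r * f r y := by
    simp [T, Fintype.linearCombination_apply]
  have hdisj : Disjoint (T '' stdSimplex ℝ κ) (Set.Iic v) := by
    rw [Set.disjoint_left]
    rintro _ ⟨w, hw, rfl⟩ hle
    obtain ⟨y, hy⟩ := hcon w hw
    exact absurd (hle y) (by simpa [hT] using hy)
  obtain ⟨g, a, b, hga, hab, hgb⟩ := geometric_hahn_banach_compact_closed
    ((convex_stdSimplex ℝ κ).linear_image T)
    ((isCompact_stdSimplex ℝ κ).image T.continuous_of_finiteDimensional)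
    (convex_Iic v) isClosed_Iic hdisj
  have hgsum (x : ι → ℝ) : g x = ∑ y, x y * g (Pi.single y 1) := by
    conv_lhs => rw [pi_eq_sum_univ' x]
    simp [map_sum, Pi.single]
  have hfa (r : κ) : g (f r) < a := by
    refine hga _ ⟨Pi.single r 1, single_mem_stdSimplex ℝ r, ?_⟩
    simp [T]
  have hbv : b < g v := hgb v Set.self_mem_Iic
  have hneg (y : ι) : g (Pi.single y 1) ≤ 0 := by
    by_contra! hpos
    set t := (g v - b) / g (Pi.single y 1) with ht
    have ht0 : 0 ≤ t := div_nonneg (by linarith) hpos.le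
    have := hgb (v - t • Pi.single y 1) (by
      refine sub_le_self v (smul_nonneg ht0 ?_)
      simp)
    rw [map_sub, map_smul, smul_eq_mul, ht, div_mul_cancel₀ _ hpos.ne'] at this
    linarith
  set s := ∑ y, -g (Pi.single y 1) with hs
  have hs0 : 0 ≤ s := Finset.sum_nonneg fun y _ => neg_nonneg.2 (hneg y)
  obtain ⟨r₀⟩ := ‹Nonempty κ›
  have hspos : 0 < s := by
    refine hs0.lt_of_ne fun h0 => ?_
    have hz := (Finset.sum_eq_zero_iff_of_nonneg
      (fun y _ => neg_nonneg.2 (hneg y))).1 h0.symm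
    have hg0 (x : ι → ℝ) : g x = 0 := by
      rw [hgsum]
      exact Finset.sum_eq_zero fun y hy => by rw [neg_eq_zero.1 (hz y hy), mul_zero]
    have := hfa r₀
    rw [hg0] at this hbv
    linarith
  have hp (x : ι → ℝ) : ∑ y, -g (Pi.single y 1) / s * x y = -g x / s := by
    rw [hgsum x, ← Finset.sum_neg_distrib, Finset.sum_div]
    exact Finset.sum_congr rfl fun y _ => by ring
  obtain ⟨r, hr⟩ := h (fun y => -g (Pi.single y 1) / s)
    ⟨fun y => div_nonneg (neg_nonneg.2 (hneg y)) hs0, by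
      rw [← Finset.sum_div, ← hs, div_self hspos.ne']⟩
  rw [hp, hp, div_le_div_iff_of_pos_right hspos] at hr
  linarith [hfa r]

/-- A point of the standard simplex has a coordinate at least the average `1 / card`. -/
theorem exists_inv_card_le_of_mem_stdSimplex {κ : Type*} [Fintype κ] [Nonempty κ] {w : κ → ℝ}
    (hw : w ∈ stdSimplex ℝ κ) : ∃ r, (Fintype.card κ : ℝ)⁻¹ ≤ w r := by
  obtain ⟨r, -, hr⟩ := Finset.exists_le_of_sum_le
    (s := Finset.univ) (f := fun _ : κ => (Fintype.card κ : ℝ)⁻¹) (g := w)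
    Finset.univ_nonempty (by simp [hw.2])
  exact ⟨r, hr⟩

/-- If every `⟨p, v⟩` dominates the minimum of the `⟨p, f r⟩`, then some `r` has, simultaneously for
all `p`, a regret at most `card κ` times the excess of `⟨p, v⟩` over any lower bound. -/
theorem exists_forall_regret_le {ι κ : Type*} [Fintype ι] [Fintype κ] [Nonempty κ]
    (f : κ → ι → ℝ) (v : ι → ℝ)
    (h : ∀ p ∈ stdSimplex ℝ ι, ∃ r, ∑ y, p y * f r y ≤ ∑ y, p y * v y) :
    ∃ r, ∀ p ∈ stdSimplex ℝ ι, ∀ m : ℝ, (∀ r', m ≤ ∑ y, p y * f r' y) →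
      (Fintype.card κ : ℝ)⁻¹ * (∑ y, p y * f r y - m) + m ≤ ∑ y, p y * v y := by
  obtain ⟨w, hw, hle⟩ := exists_mem_stdSimplex_sum_mul_le f v h
  obtain ⟨r, hr⟩ := exists_inv_card_le_of_mem_stdSimplex hw
  refine ⟨r, fun p hp m hm => ?_⟩
  calc (Fintype.card κ : ℝ)⁻¹ * (∑ y, p y * f r y - m) + m
      ≤ w r * (∑ y, p y * f r y - m) + m := by
        gcongr
        exact sub_nonneg.2 (hm r)
    _ ≤ ∑ r', w r' * (∑ y, p y * f r' y - m) + m := by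
        gcongr
        exact Finset.single_le_sum (f := fun r' => w r' * (∑ y, p y * f r' y - m))
          (fun r' _ => mul_nonneg (hw.1 r') (sub_nonneg.2 (hm r'))) (Finset.mem_univ r)
    _ = ∑ y, p y * ∑ r', w r' * f r' y := by
        simp only [mul_sub, Finset.sum_sub_distrib, ← Finset.sum_mul, hw.2, one_mul,
          sub_add_cancel, Finset.mul_sum]
        rw [Finset.sum_comm]
        exact Finset.sum_congr rfl fun _ _ => Finset.sum_congr rfl fun _ _ => by ring
    _ ≤ ∑ y, p y * v y :=
        Finset.sum_le_sum fun y _ => mul_le_mul_of_nonneg_left (hle y) (hp.1 y)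

/-- A finite family of reals bounded below by `m` has a uniform gap above `m`
among the members different from `m`. -/
theorem exists_pos_forall_add_le_of_lt {κ : Type*} [Finite κ] (c : κ → ℝ) (m : ℝ) :
    ∃ δ > (0 : ℝ), ∀ r, m < c r → δ ≤ c r - m := by
  have hfin : (Set.range c \ Set.Iic m).Finite := (Set.finite_range c).sdiff
  obtain hemp | hne := (Set.range c \ Set.Iic m).eq_empty_or_nonempty
  · refine ⟨1, one_pos, fun r hr => ?_⟩
    have : c r ∈ Set.range c \ Set.Iic m := ⟨⟨r, rfl⟩, not_le.2 hr⟩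
    simp [hemp] at this
  · obtain ⟨x, hx, hmin⟩ := hfin.exists_minimal hne
    refine ⟨x - m, sub_pos.2 (not_le.1 hx.2), fun r hr => ?_⟩
    have hmem : c r ∈ Set.range c \ Set.Iic m := ⟨⟨r, rfl⟩, not_le.2 hr⟩
    have := (le_total x (c r)).elim id fun hle => hmin hmem hle
    linarith

theorem stmt6 (d n : ℕ) (hd : 1 ≤ d) (hn : 2 ≤ n)
    (L : (Fin d → ℝ) → Fin n → ℝ) (hLnn : ∀ u y, 0 ≤ L u y)
    (hpoly : ∀ y : Fin n, ∃ m : ℕ, ∃ a : Fin (m + 1) → Fin d → ℝ, ∃ b : Fin (m + 1) → ℝ,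
      ∀ u : Fin d → ℝ,
        L u y = Finset.univ.sup' Finset.univ_nonempty (fun j => (∑ i, a j i * u i) + b j))
    (hattain : ∀ p ∈ simplex n, ∃ u : Fin d → ℝ, ∀ v : Fin d → ℝ,
      ∑ y, p y * L u y ≤ ∑ y, p y * L v y)
    {Rh R : Type} [Fintype Rh] [Nonempty Rh] [Fintype R] [Nonempty R]
    (lh : Rh → Fin n → ℝ) (hlh : ∀ r y, 0 ≤ lh r y)
    (l : R → Fin n → ℝ) (hl : ∀ r y, 0 ≤ l r y)
    (P : Set (Fin n → ℝ)) (hP : P ⊆ simplex n)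
    (S : Set Rh) (φ : Rh → Fin d → ℝ)
    (hSrep : ∀ p ∈ simplex n, ∃ r ∈ S, ∀ r' : Rh,
      ∑ y, p y * lh r y ≤ ∑ y, p y * lh r' y)
    (hinj : Set.InjOn φ S)
    (hmatch : ∀ r ∈ S, ∀ y : Fin n, L (φ r) y = lh r y)
    (hiff : ∀ p ∈ simplex n, ∀ r ∈ S,
      ((∀ r' : Rh, ∑ y, p y * lh r y ≤ ∑ y, p y * lh r' y) ↔
        (∀ u : Fin d → ℝ, ∑ y, p y * L (φ r) y ≤ ∑ y, p y * L u y)))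
    (hlink : ∀ rh : Rh, ∃ r : R,
      {p ∈ P | ∀ r' : Rh, ∑ y, p y * lh rh y ≤ ∑ y, p y * lh r' y} ⊆
        {p ∈ P | ∀ r' : R, ∑ y, p y * l r y ≤ ∑ y, p y * l r' y}) :
    ∃ ψ : (Fin d → ℝ) → R, ∀ p ∈ P, ∃ ε > (0 : ℝ), ∀ u : Fin d → ℝ,
      ¬ (∀ r' : R, ∑ y, p y * l (ψ u) y ≤ ∑ y, p y * l r' y) →
      ε + sInf (Set.range fun u' => ∑ y, p y * L u' y) ≤ ∑ y, p y * L u y := by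
  have hdom (p) (hp : p ∈ simplex n) : ∃ r ∈ S,
      (∀ r' : Rh, ∑ y, p y * lh r y ≤ ∑ y, p y * lh r' y) ∧
      ∀ u, ∑ y, p y * lh r y ≤ ∑ y, p y * L u y := by
    obtain ⟨r, hrS, hr⟩ := hSrep p hp
    refine ⟨r, hrS, hr, fun u => ?_⟩
    simpa only [hmatch r hrS] using (hiff p hp r hrS).1 hr u
  choose ρ hρ using fun u => exists_forall_regret_le lh (L u) fun p hp =>
    (hdom p hp).imp fun _ hr => hr.2.2 u
  choose link hlink using hlink
  refine ⟨fun u => link (ρ u), fun p hp => ?_⟩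
  obtain ⟨r₀, hr₀S, hmin, -⟩ := hdom p (hP hp)
  set m := ∑ y, p y * lh r₀ y with hm
  obtain ⟨δ, hδ, hgap⟩ := exists_pos_forall_add_le_of_lt (fun r => ∑ y, p y * lh r y) m
  refine ⟨(Fintype.card Rh : ℝ)⁻¹ * δ, by positivity, fun u hu => ?_⟩
  have hlt : m < ∑ y, p y * lh (ρ u) y := by
    by_contra! hle
    exact hu (hlink (ρ u) ⟨hp, fun r' => hle.trans (hmin r')⟩).2
  have hinf : sInf (Set.range fun u' => ∑ y, p y * L u' y) ≤ m := by
    refine csInf_le ⟨0, ?_⟩ ⟨φ r₀, by simp only [hmatch r₀ hr₀S, hm]⟩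
    rintro _ ⟨u', rfl⟩
    exact Finset.sum_nonneg fun y _ => mul_nonneg ((hP hp).1 y) (hLnn u' y)
  calc (Fintype.card Rh : ℝ)⁻¹ * δ + sInf (Set.range fun u' => ∑ y, p y * L u' y)
      ≤ (Fintype.card Rh : ℝ)⁻¹ * (∑ y, p y * lh (ρ u) y - m) + m := by
        gcongr
        exact hgap _ hlt
    _ ≤ ∑ y, p y * L u y := hρ u p (hP hp) m hmin
end

section
/- Let u ∈ ℝ^n have its (k+1)-th largest entry equal to 0, and let u' ∈ ℝ^n be defined coordinatewise by u'_i = max(u_i, 0). Then L^(2)(u, y) ≥ L^(2)(u', y) for every y ∈ Y. (Hence, using invariance in the all-ones direction, the set R_low = {u ∈ ℝ^n : u_i ≥ 0 for all i and u has at most k nonzero entries} is representative for L^(2).) -/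
open scoped NNReal

/-- A linear functional that is bounded below on a nonempty polyhedron attains its minimum there. -/
theorem exists_isMinOn_polyhedron {E ι : Type*} [AddCommGroup E] [Module ℝ E] [Finite ι]
    (φ : ι → E →ₗ[ℝ] ℝ) (c : ι → ℝ) (ℓ : E →ₗ[ℝ] ℝ) (B : ℝ)
    (hne : ∃ x, ∀ i, φ i x ≤ c i) (hB : ∀ x, (∀ i, φ i x ≤ c i) → B ≤ ℓ x) :
    ∃ x, (∀ i, φ i x ≤ c i) ∧ ∀ z, (∀ i, φ i z ≤ c i) → ℓ x ≤ ℓ z := by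
  classical
  have := Fintype.ofFinite ι
  let active : E → Finset ι := fun x => Finset.univ.filter fun i => φ i x = c i
  have mem_active : ∀ x i, i ∈ active x ↔ φ i x = c i := fun x i => by simp [active]
  have step : ∀ x d, (∀ i, φ i x ≤ c i) → (∀ i ∈ active x, φ i d = 0) → ℓ d < 0 →
      ∃ z, (∀ i, φ i z ≤ c i) ∧ ℓ z ≤ ℓ x ∧ active x ⊂ active z := by
    intro x d hx hd hℓ
    obtain ⟨i₀, hi₀⟩ : ∃ i, 0 < φ i d := by
      by_contra! hcon
      have hBx := hB x hx
      have ht : 0 ≤ (ℓ x - B + 1) / (-ℓ d) := div_nonneg (by linarith) (by linarith)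
      have := hB (x + ((ℓ x - B + 1) / (-ℓ d)) • d) fun i => by
        have := mul_nonneg ht (neg_nonneg.2 (hcon i))
        simp only [map_add, map_smul, smul_eq_mul]
        linarith [hx i]
      have h2 : (ℓ x - B + 1) / (-ℓ d) * ℓ d = -(ℓ x - B + 1) := by
        field_simp [hℓ.ne]
      simp only [map_add, map_smul, smul_eq_mul] at this
      linarith
    obtain ⟨j, hj, hmin⟩ := (Finset.univ.filter fun i => 0 < φ i d).exists_min_image
      (fun i => (c i - φ i x) / φ i d) ⟨i₀, by simpa using hi₀⟩
    replace hj : 0 < φ j d := by simpa using hj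
    set t := (c j - φ j x) / φ j d with ht_def
    have ht : 0 ≤ t := div_nonneg (by linarith [hx j]) hj.le
    refine ⟨x + t • d, fun i => ?_, ?_, ?_⟩
    · simp only [map_add, map_smul, smul_eq_mul]
      rcases le_or_gt (φ i d) 0 with h | h
      · linarith [hx i, mul_nonneg ht (neg_nonneg.2 h)]
      · have := (le_div_iff₀ h).1 (hmin i (by simpa using h))
        linarith
    · simp only [map_add, map_smul, smul_eq_mul]
      linarith [mul_nonneg ht (neg_nonneg.2 hℓ.le)]
    · refine (Finset.ssubset_iff_of_subset fun i hi => ?_).2 ⟨j, ?_, fun h => ?_⟩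
      · rw [mem_active]
        simpa [hd i hi] using (mem_active x i).1 hi
      · rw [mem_active]
        simp only [map_add, map_smul, smul_eq_mul, ht_def]
        rw [div_mul_cancel₀ _ hj.ne']
        ring
      · exact hj.ne' (hd j h)
  let Good : E → Prop := fun x =>
    (∀ i, φ i x ≤ c i) ∧ ∀ d, (∀ i ∈ active x, φ i d = 0) → ℓ d = 0
  have exists_good : ∀ x, (∀ i, φ i x ≤ c i) → ∃ z, Good z ∧ ℓ z ≤ ℓ x := by
    intro x hx
    induction h : (active x)ᶜ.card using Nat.strong_induction_on generalizing x with
    | _ m ih =>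
      by_cases hg : ∀ d, (∀ i ∈ active x, φ i d = 0) → ℓ d = 0
      · exact ⟨x, ⟨hx, hg⟩, le_rfl⟩
      push Not at hg
      obtain ⟨d, hd, hne⟩ := hg
      obtain ⟨e, he, hneg⟩ : ∃ e, (∀ i ∈ active x, φ i e = 0) ∧ ℓ e < 0 := by
        rcases hne.lt_or_gt with h | h
        · exact ⟨d, hd, h⟩
        · exact ⟨-d, fun i hi => by simp [hd i hi], by simpa using h⟩
      obtain ⟨z, hz, hle, hss⟩ := step x e hx he hneg
      obtain ⟨w, hw, hwz⟩ := ih _ (h ▸ Finset.card_lt_card (compl_lt_compl_iff_lt.2 hss)) z hz rfl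
      exact ⟨w, hw, hwz.trans hle⟩
  have eq_of_active : ∀ x z, Good x → Good z → active x = active z → ℓ x = ℓ z := by
    intro x z hx hz h
    have := hx.2 (x - z) fun i hi => by
      rw [map_sub, (mem_active x i).1 hi, (mem_active z i).1 (h ▸ hi), sub_self]
    rwa [map_sub, sub_eq_zero] at this
  obtain ⟨x₀, hx₀⟩ := hne
  obtain ⟨z₀, hz₀, -⟩ := exists_good x₀ hx₀
  have hrep : ∀ A : Finset ι, ∃ x, Good x ∧ ∀ z, Good z → active z = A → ℓ z = ℓ x := by
    intro A
    by_cases h : ∃ x, Good x ∧ active x = A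
    · obtain ⟨x, hx, rfl⟩ := h
      exact ⟨x, hx, fun z hz hA => eq_of_active z x hz hx hA⟩
    · exact ⟨z₀, hz₀, fun z hz hA => absurd ⟨z, hz, hA⟩ h⟩
  choose g hg hgeq using hrep
  obtain ⟨A, hA⟩ := Finite.exists_min fun A => ℓ (g A)
  refine ⟨g A, (hg A).1, fun z hz => ?_⟩
  obtain ⟨w, hw, hwz⟩ := exists_good z hz
  exact ((hA (active w)).trans_eq (hgeq _ w hw rfl).symm).trans hwz

theorem sigmaTop_le_iff {n m : ℕ} (hm : m ≤ n) {u : Fin n → ℝ} {a : ℝ} :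
    sigmaTop n m u ≤ a ↔ ∀ S : Finset (Fin n), S.card = m → ∑ i ∈ S, u i ≤ a := by
  have h : ((Finset.univ : Finset (Fin n)).powersetCard m).Nonempty :=
    Finset.powersetCard_nonempty.2 (by simpa using hm)
  rw [sigmaTop, dif_pos h]
  simp [Finset.mem_powersetCard]

theorem L2_le_iff {n k : ℕ} (hk : 1 ≤ k) (hkn : k ≤ n) {u : Fin n → ℝ} {y : Fin n} {a : ℝ} :
    L2 n k u y ≤ a ↔ 0 ≤ a ∧ ∀ S : Finset (Fin n), S.card = k →
      1 - u y + (1 / (k : ℝ)) * ∑ i ∈ S, (u i - (Pi.single y 1 : Fin n → ℝ) i) ≤ a := by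
  have hk' : (0 : ℝ) < 1 / k := by positivity
  have key : ∀ s : ℝ, 1 - u y + (1 / (k : ℝ)) * s ≤ a ↔ s ≤ (a - (1 - u y)) / (1 / (k : ℝ)) := by
    intro s
    rw [le_div_iff₀ hk', ← le_sub_iff_add_le', mul_comm]
  rw [L2, max_le_iff, key, sigmaTop_le_iff hkn]
  simp only [key, Pi.sub_apply]

theorem L2_nonneg {n k : ℕ} (u : Fin n → ℝ) (y : Fin n) : 0 ≤ L2 n k u y := le_max_left _ _

theorem L2_sub_const_le {n k : ℕ} (hk : 1 ≤ k) (hkn : k ≤ n) (u : Fin n → ℝ) (c : ℝ)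
    (y : Fin n) : L2 n k (fun i => u i - c) y ≤ L2 n k u y := by
  refine (L2_le_iff hk hkn).2 ⟨L2_nonneg u y, fun S hS => ?_⟩
  have h := ((L2_le_iff hk hkn).1 (le_refl (L2 n k u y))).2 S hS
  have hk' : (k : ℝ) ≠ 0 := by positivity
  convert h using 1
  simp only [Finset.sum_sub_distrib, Finset.sum_const, hS, nsmul_eq_mul]
  field_simp
  ring

theorem nthLarge_sub_const {n : ℕ} (u : Fin n → ℝ) {j : ℕ} (hj : n - j < n) (c : ℝ) :
    nthLarge (fun i => u i - c) j = nthLarge u j - c := by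
  have h : (fun i => u i - c) ∘ Tuple.sort u =
      (fun i => u i - c) ∘ Tuple.sort fun i => u i - c :=
    Tuple.comp_sort_eq_comp_iff_monotone.2 fun a b hab =>
      sub_le_sub_right (Tuple.monotone_sort u hab) c
  simpa [nthLarge, hj] using (congrFun h ⟨n - j, hj⟩).symm

theorem exists_card_eq_of_nthLarge_eq_zero {n k : ℕ} (hkn : k < n) {u : Fin n → ℝ}
    (hu : nthLarge u (k + 1) = 0) :
    ∃ P : Finset (Fin n), P.card = k + 1 ∧ (∀ i ∈ P, 0 ≤ u i) ∧ (∀ i ∉ P, u i ≤ 0) ∧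
      ∃ z ∈ P, u z = 0 := by
  have hlt : n - (k + 1) < n := by omega
  set a : Fin n := ⟨n - (k + 1), hlt⟩ with ha
  have hz : u (Tuple.sort u a) = 0 := by simpa [nthLarge, hlt] using hu
  have hmono := Tuple.monotone_sort u
  refine ⟨(Finset.Ici a).map (Tuple.sort u).toEmbedding, ?_, ?_, ?_, Tuple.sort u a, ?_, hz⟩
  · rw [Finset.card_map, Fin.card_Ici, ha]
    simp only
    omega
  · intro i hi
    obtain ⟨b, hb, rfl⟩ := Finset.mem_map.1 hi
    exact hz.symm.trans_le (hmono (Finset.mem_Ici.1 hb))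
  · intro i hi
    obtain ⟨b, rfl⟩ := (Tuple.sort u).surjective i
    have hb : ¬ a ≤ b := fun h => hi (Finset.mem_map.2 ⟨b, Finset.mem_Ici.2 h, rfl⟩)
    exact (hmono (not_le.1 hb).le).trans_eq hz
  · exact Finset.mem_map.2 ⟨a, Finset.mem_Ici.2 le_rfl, rfl⟩

theorem Finset.sum_le_sum_of_support {α : Type*} {f : α → ℝ} (hf : ∀ i, 0 ≤ f i)
    {S Q : Finset α} (h : ∀ i ∈ S, i ∉ Q → f i = 0) : ∑ i ∈ S, f i ≤ ∑ i ∈ Q, f i := by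
  classical
  rw [← Finset.sum_subset (Finset.inter_subset_left : S ∩ Q ⊆ S)
    fun i hi hi' => h i hi fun hQ => hi' (Finset.mem_inter.2 ⟨hi, hQ⟩)]
  exact Finset.sum_le_sum_of_subset_of_nonneg Finset.inter_subset_right fun i _ _ => hf i

theorem L2_posPart_le {n k : ℕ} (hk : 1 ≤ k) (hkn : k < n) {u : Fin n → ℝ}
    (hu : nthLarge u (k + 1) = 0) (y : Fin n) :
    L2 n k (fun i => max (u i) 0) y ≤ L2 n k u y := by
  obtain ⟨P, hP, hpos, hneg, z, hzP, hz⟩ := exists_card_eq_of_nthLarge_eq_zero hkn hu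
  refine (L2_le_iff hk hkn.le).2 ⟨L2_nonneg u y, fun S hS => ?_⟩
  have hL := ((L2_le_iff hk hkn.le).1 (le_refl (L2 n k u y))).2
  have hsum : ∀ Q ⊆ P, ∑ i ∈ Q, max (u i) 0 = ∑ i ∈ Q, u i := fun Q hQ =>
    Finset.sum_congr rfl fun i hi => max_eq_left (hpos i (hQ hi))
  have hcard : ∀ i ∈ P, (P.erase i).card = k := fun i hi => by
    rw [Finset.card_erase_of_mem hi, hP, Nat.add_sub_cancel]
  have hle : ∀ i ∈ P, i ∉ S ∨ u i = 0 → ∑ j ∈ S, max (u j) 0 ≤ ∑ j ∈ P.erase i, u j := by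
    intro i hi hiS
    rw [← hsum _ (Finset.erase_subset i P)]
    refine Finset.sum_le_sum_of_support (fun j => le_max_right _ _) fun j hj hjP => ?_
    by_cases hji : j = i
    · subst hji
      simp [hiS.resolve_left (not_not.2 hj)]
    · exact max_eq_right (hneg j fun h => hjP (Finset.mem_erase.2 ⟨hji, h⟩))
  have hsingle : ∀ Q : Finset (Fin n),
      ∑ i ∈ Q, (Pi.single y 1 : Fin n → ℝ) i = if y ∈ Q then 1 else 0 := fun Q => by
    simp [Pi.single_apply]
  obtain ⟨Q, hQ, hSQ⟩ : ∃ Q : Finset (Fin n), Q.card = k ∧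
      ∑ i ∈ S, (max (u i) 0 - (Pi.single y 1 : Fin n → ℝ) i) ≤
        ∑ i ∈ Q, (u i - (Pi.single y 1 : Fin n → ℝ) i) := by
    simp only [Finset.sum_sub_distrib, hsingle]
    by_cases hyP : y ∈ P
    · by_cases hyS : y ∈ S
      · obtain ⟨i, hiP, hiS⟩ := Finset.exists_mem_notMem_of_card_lt_card (s := S) (t := P) (by omega)
        have hyi : y ≠ i := fun h => hiS (h ▸ hyS)
        exact ⟨P.erase i, hcard i hiP, by simpa [hyS, hyP, hyi] using hle i hiP (.inl hiS)⟩
      · exact ⟨P.erase y, hcard y hyP, by simpa [hyS] using hle y hyP (.inl hyS)⟩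
    · refine ⟨P.erase z, hcard z hzP, ?_⟩
      have h := hle z hzP (.inr hz)
      have h01 : (0 : ℝ) ≤ if y ∈ S then 1 else 0 := by split_ifs <;> norm_num
      rw [if_neg fun h => hyP (Finset.mem_of_mem_erase h)]
      linarith
  have hmul := mul_le_mul_of_nonneg_left hSQ (by positivity : (0 : ℝ) ≤ 1 / k)
  have := hL Q hQ
  have := le_max_left (u y) 0
  linarith

theorem exists_forall_sum_mul_L2_le {n k : ℕ} (hk : 1 ≤ k) (hkn : k ≤ n) {p : Fin n → ℝ}
    (hp : ∀ i, 0 ≤ p i) :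
    ∃ u : Fin n → ℝ, ∀ v : Fin n → ℝ, ∑ y, p y * L2 n k u y ≤ ∑ y, p y * L2 n k v y := by
  let U : Fin n → (Fin n → ℝ) × (Fin n → ℝ) →ₗ[ℝ] ℝ := fun i =>
    LinearMap.proj i ∘ₗ LinearMap.fst ℝ _ _
  let W : Fin n → (Fin n → ℝ) × (Fin n → ℝ) →ₗ[ℝ] ℝ := fun i =>
    LinearMap.proj i ∘ₗ LinearMap.snd ℝ _ _
  let ι := Fin n ⊕ (Fin n × {S : Finset (Fin n) // S.card = k})
  let φ : ι → (Fin n → ℝ) × (Fin n → ℝ) →ₗ[ℝ] ℝ := Sum.elim (fun y => -W y)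
    fun a => (1 / (k : ℝ)) • ∑ i ∈ a.2.1, U i - U a.1 - W a.1
  let c : ι → ℝ := Sum.elim (fun _ => 0)
    fun a => (1 / (k : ℝ)) * ∑ i ∈ a.2.1, (Pi.single a.1 1 : Fin n → ℝ) i - 1
  have feasible_iff : ∀ x : (Fin n → ℝ) × (Fin n → ℝ),
      (∀ i, φ i x ≤ c i) ↔ ∀ y, L2 n k x.1 y ≤ x.2 y := by
    intro x
    simp only [L2_le_iff hk hkn, forall_and, Sum.forall, ι]
    refine and_congr ?_ ?_
    · simp [φ, c, W]
    · simp only [Prod.forall, Subtype.forall]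
      refine forall₃_congr fun y S hS => ?_
      simp only [φ, c, U, W, Sum.elim_inr, LinearMap.sub_apply, LinearMap.smul_apply,
        LinearMap.sum_apply, LinearMap.comp_apply, LinearMap.proj_apply, LinearMap.fst_apply,
        LinearMap.snd_apply, smul_eq_mul, Finset.sum_sub_distrib, mul_sub]
      constructor <;> intro h <;> linarith
  let ℓ : (Fin n → ℝ) × (Fin n → ℝ) →ₗ[ℝ] ℝ := ∑ y, p y • W y
  have ℓ_apply : ∀ x : (Fin n → ℝ) × (Fin n → ℝ), ℓ x = ∑ y, p y * x.2 y := fun x => by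
    simp [ℓ, W, LinearMap.sum_apply]
  obtain ⟨x, hx, hmin⟩ := exists_isMinOn_polyhedron φ c ℓ 0
    ⟨(0, L2 n k 0), (feasible_iff _).2 fun _ => le_rfl⟩ fun x hx => by
      rw [ℓ_apply]
      exact Finset.sum_nonneg fun y _ => mul_nonneg (hp y)
        ((L2_nonneg _ _).trans ((feasible_iff x).1 hx y))
  refine ⟨x.1, fun v => ?_⟩
  have h := hmin (v, L2 n k v) ((feasible_iff _).2 fun _ => le_rfl)
  rw [ℓ_apply, ℓ_apply] at h
  exact (Finset.sum_le_sum fun y _ =>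
    mul_le_mul_of_nonneg_left ((feasible_iff x).1 hx y) (hp y)).trans h

theorem stmt8 (n k : ℕ) (hk : 1 ≤ k) (hkn : k < n) :
    (∀ u : Fin n → ℝ, nthLarge u (k + 1) = 0 →
      ∀ y : Fin n, L2 n k (fun i => max (u i) 0) y ≤ L2 n k u y) ∧
    (∀ p ∈ simplex n, ∃ u : Fin n → ℝ,
      ((∀ i, 0 ≤ u i) ∧ ∃ T : Finset (Fin n), T.card ≤ k ∧ ∀ i ∉ T, u i = 0) ∧
      ∀ v : Fin n → ℝ, ∑ y, p y * L2 n k u y ≤ ∑ y, p y * L2 n k v y) := by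
  refine ⟨fun u hu y => L2_posPart_le hk hkn hu y, fun p hp => ?_⟩
  obtain ⟨v, hv⟩ := exists_forall_sum_mul_L2_le hk hkn.le hp.1
  set w : Fin n → ℝ := fun i => v i - nthLarge v (k + 1) with hw
  have hw0 : nthLarge w (k + 1) = 0 := by
    rw [hw, nthLarge_sub_const v (by omega), sub_self]
  obtain ⟨P, hP, -, hneg, z, hzP, hz⟩ := exists_card_eq_of_nthLarge_eq_zero hkn hw0
  refine ⟨fun i => max (w i) 0, ⟨fun i => le_max_right _ _, P.erase z, ?_, fun i hi => ?_⟩,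
    fun v' => (Finset.sum_le_sum fun y _ => mul_le_mul_of_nonneg_left ?_ (hp.1 y)).trans (hv v')⟩
  · rw [Finset.card_erase_of_mem hzP, hP, Nat.add_sub_cancel]
  · by_cases hiz : i = z
    · simp [hiz, hz]
    · exact max_eq_right (hneg i fun h => hi (Finset.mem_erase.2 ⟨hiz, h⟩))
  · exact (L2_posPart_le hk hkn hw0 y).trans (L2_sub_const_le hk hkn.le v _ y)
end

section
/- Let H, M ⊆ Y be disjoint, let i ∈ Y ∖ (H ∪ M), and assume 1 ≤ |H| + |M|, |H| + |M| + 1 ≤ k, and |H| + 1 < k. Then for every p in the simplex Δ, Σ_{y∈Y} p_y ℓ̂_2((H∪{i}, M), y) ≤ Σ_{y∈Y} p_y ℓ̂_2((H, M∪{i}), y) if and only if p_i ≥ (1 − Σ_{j∈H} p_j)/(k − |H|). -/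
open scoped NNReal

theorem ell2_insert_sub_ell2_insert {n : ℕ} (k : ℕ) (H M : Finset (Fin n)) (i : Fin n)
    (hi : i ∉ H ∪ M) (y : Fin n) :
    ell2 k H (insert i M) y - ell2 k (insert i H) M y =
      (((H.card : ℝ) + M.card) / (k - H.card) - ((H.card : ℝ) + M.card) / (k - H.card - 1)) *
          (1 - if y ∈ H then 1 else 0) +
        ((H.card : ℝ) + M.card) / (k - H.card - 1) * (if y = i then 1 else 0) := by
  obtain ⟨hiH, hiM⟩ : i ∉ H ∧ i ∉ M := by simpa using hi
  have hnumH : (H.card : ℝ) + 1 + M.card - 1 = H.card + M.card := by ring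
  have hnumM : (H.card : ℝ) + (M.card + 1) - 1 = H.card + M.card := by ring
  have hden : (k : ℝ) - (H.card + 1) = k - H.card - 1 := by ring
  simp only [ell2, Finset.card_insert_of_notMem hiH, Finset.card_insert_of_notMem hiM,
    Finset.mem_insert, Nat.cast_add, Nat.cast_one, hnumH, hnumM, hden]
  by_cases hy : y = i
  · subst hy
    simp [hiH]
  · by_cases hyH : y ∈ H <;> by_cases hyM : y ∈ M <;> simp [hy, hyH, hyM]

theorem sum_mul_ell2_insert_sub {n : ℕ} (k : ℕ) (H M : Finset (Fin n)) (i : Fin n)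
    (hi : i ∉ H ∪ M) {p : Fin n → ℝ} (hp : ∑ y, p y = 1) :
    ∑ y, p y * ell2 k H (insert i M) y - ∑ y, p y * ell2 k (insert i H) M y =
      (((H.card : ℝ) + M.card) / (k - H.card) - ((H.card : ℝ) + M.card) / (k - H.card - 1)) *
          (1 - ∑ j ∈ H, p j) +
        ((H.card : ℝ) + M.card) / (k - H.card - 1) * p i := by
  have hH : ∑ y, p y * (1 - if y ∈ H then 1 else 0) = 1 - ∑ j ∈ H, p j := by
    simp [mul_sub, hp]
  have hpi : ∑ y, p y * (if y = i then 1 else 0) = p i := by simp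
  rw [← Finset.sum_sub_distrib, ← hH, ← hpi, Finset.mul_sum, Finset.mul_sum,
    ← Finset.sum_add_distrib]
  refine Finset.sum_congr rfl fun y _ => ?_
  rw [← mul_sub, ell2_insert_sub_ell2_insert k H M i hi y]
  ring

theorem stmt11 (n k : ℕ) (hk : 1 ≤ k) (hkn : k < n)
    (H M : Finset (Fin n)) (hdisj : Disjoint H M) (i : Fin n)
    (hi : i ∉ H ∪ M) (h1 : 1 ≤ H.card + M.card) (h2 : H.card + M.card + 1 ≤ k)
    (h3 : H.card + 1 < k) :
    ∀ p ∈ simplex n,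
      ((∑ y, p y * ell2 k (insert i H) M y) ≤ (∑ y, p y * ell2 k H (insert i M) y) ↔
        (1 - ∑ j ∈ H, p j) / ((k : ℝ) - H.card) ≤ p i) := by
  intro p hp
  have hs : (0 : ℝ) < H.card + M.card := by exact_mod_cast h1
  have hd : (0 : ℝ) < k - H.card - 1 := by
    have : (H.card : ℝ) + 1 < k := by exact_mod_cast h3
    linarith
  have hd' : (0 : ℝ) < k - H.card := by linarith
  have hfactor : ∑ y, p y * ell2 k H (insert i M) y - ∑ y, p y * ell2 k (insert i H) M y =
      ((H.card : ℝ) + M.card) / ((k - H.card) * (k - H.card - 1)) *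
        (p i * (k - H.card) - (1 - ∑ j ∈ H, p j)) := by
    rw [sum_mul_ell2_insert_sub k H M i hi hp.2]
    field_simp
    ring
  rw [← sub_nonneg, hfactor, mul_nonneg_iff_of_pos_left (by positivity), sub_nonneg,
    div_le_iff₀ hd']
end

section
/- Let u ∈ ℝ^n have its (k+1)-th largest entry equal to 0, and let u' ∈ ℝ^n be defined coordinatewise by u'_i = max(u_i, 0). Then L^(3)(u, y) ≥ L^(3)(u', y) for every y ∈ Y. (Hence the set R_low = {u ∈ ℝ^n : u_i ≥ 0 for all i and u has at most k nonzero entries} is representative for L^(3).) -/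
open scoped NNReal

theorem nthLarge_eq {n : ℕ} (v : Fin n → ℝ) {j : ℕ} (h : n - j < n) :
    nthLarge v j = v (Tuple.sort v ⟨n - j, h⟩) := dif_pos h

theorem le_nthLarge_iff {n : ℕ} (v : Fin n → ℝ) {j : ℕ} (hj : 1 ≤ j) (hjn : j ≤ n) (c : ℝ) :
    c ≤ nthLarge v j ↔ j ≤ (Finset.univ.filter fun i => c ≤ v i).card := by
  have h : n - j < n := by omega
  have hm : Monotone (v ∘ Tuple.sort v) := Tuple.monotone_sort v
  rw [nthLarge_eq v h]
  constructor
  · intro hc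
    have hsub : (Finset.Ici (⟨n - j, h⟩ : Fin n)).map (Tuple.sort v).toEmbedding ⊆
        Finset.univ.filter fun i => c ≤ v i := by
      intro i hi
      obtain ⟨a, ha, rfl⟩ := Finset.mem_map.1 hi
      simpa using hc.trans (hm (Finset.mem_Ici.1 ha))
    have hcard := Finset.card_le_card hsub
    rw [Finset.card_map, Fin.card_Ici] at hcard
    dsimp only at hcard
    omega
  · intro hc
    by_contra hlt
    have hsub : (Finset.univ.filter fun i => c ≤ v i) ⊆
        (Finset.Ioi (⟨n - j, h⟩ : Fin n)).map (Tuple.sort v).toEmbedding := by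
      intro i hi
      refine Finset.mem_map.2 ⟨(Tuple.sort v).symm i, ?_, by simp⟩
      rw [Finset.mem_Ioi]
      by_contra hle
      have h1 := hm (not_lt.1 hle)
      simp only [Function.comp_apply, Equiv.apply_symm_apply] at h1
      exact hlt ((Finset.mem_filter.1 hi).2.trans h1)
    have hcard := Finset.card_le_card hsub
    rw [Finset.card_map, Fin.card_Ioi] at hcard
    dsimp only at hcard
    omega

theorem nthLarge_mono {n : ℕ} {v w : Fin n → ℝ} (hvw : ∀ i, v i ≤ w i) {j : ℕ} (hj : 1 ≤ j)
    (hjn : j ≤ n) : nthLarge v j ≤ nthLarge w j := by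
  refine (le_nthLarge_iff w hj hjn _).2 (((le_nthLarge_iff v hj hjn _).1 le_rfl).trans ?_)
  exact Finset.card_le_card
    (Finset.monotone_filter_right _ fun i _ (hi : nthLarge v j ≤ v i) => hi.trans (hvw i))

theorem nthLarge_comp {n : ℕ} (v : Fin n → ℝ) {φ : ℝ → ℝ} (hφ : Monotone φ) {j : ℕ}
    (hj : 1 ≤ j) (hjn : j ≤ n) : nthLarge (fun i => φ (v i)) j = φ (nthLarge v j) := by
  have h : n - j < n := by omega
  rw [nthLarge_eq _ h, nthLarge_eq _ h]
  have hmono : Monotone ((fun i => φ (v i)) ∘ Tuple.sort v) :=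
    fun a b hab => hφ (Tuple.monotone_sort v hab)
  exact (congrFun (Tuple.comp_sort_eq_comp_iff_monotone.2 hmono) ⟨n - j, h⟩).symm

theorem nthLarge_sub_single_nonneg {n k : ℕ} (hkn : k < n) {u : Fin n → ℝ}
    (hu : nthLarge u (k + 1) = 0) (y : Fin n) {i : ℕ} (hi : 1 ≤ i) (hik : i ≤ k) :
    0 ≤ nthLarge (u - Pi.single y 1) i := by
  rw [le_nthLarge_iff _ hi (by omega)]
  have hcard := (le_nthLarge_iff u (by omega) hkn 0).1 hu.ge
  have hsub : (Finset.univ.filter fun i => 0 ≤ u i).erase y ⊆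
      Finset.univ.filter fun i => 0 ≤ (u - Pi.single y 1 : Fin n → ℝ) i := by
    intro j hj
    obtain ⟨hjy, hj0⟩ := Finset.mem_erase.1 hj
    simpa [hjy] using hj0
  have h1 := Finset.card_le_card hsub
  have h2 := Finset.pred_card_le_card_erase (s := Finset.univ.filter fun i => 0 ≤ u i) (a := y)
  omega

theorem L3_posPart_le {n k : ℕ} (hkn : k < n) {u : Fin n → ℝ} (hu : nthLarge u (k + 1) = 0)
    (y : Fin n) : L3 n k (fun i => max (u i) 0) y ≤ L3 n k u y := by
  unfold L3
  refine mul_le_mul_of_nonneg_left (Finset.sum_le_sum fun i hi => ?_) (by positivity)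
  obtain ⟨hi1, hik⟩ := Finset.mem_Icc.1 hi
  have hn : i ≤ n := by omega
  have h1 : nthLarge ((fun i => max (u i) 0) - Pi.single y 1) i ≤
      nthLarge (fun j => max ((u - Pi.single y 1 : Fin n → ℝ) j) 0) i := by
    refine nthLarge_mono (fun j => ?_) hi1 hn
    by_cases hj : j = y
    · subst hj
      rcases le_total (u j) 0 with h | h <;> simp [h]
    · simp [hj]
  have h2 := nthLarge_comp (u - Pi.single y 1 : Fin n → ℝ) (φ := fun x => max x 0)
    (fun a b hab => max_le_max_right 0 hab) hi1 hn
  rw [h2, max_eq_left (nthLarge_sub_single_nonneg hkn hu y hi1 hik)] at h1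
  refine max_le_max_left 0 ?_
  have := le_max_left (u y) 0
  linarith

/-- The per-coordinate hinge terms whose `k` largest values are averaged by `L3`. -/
def hinge {n : ℕ} (u : Fin n → ℝ) (y : Fin n) : Fin n → ℝ :=
  fun j => max 0 (1 - u y + (u - Pi.single y 1 : Fin n → ℝ) j)

theorem L3_eq_hinge {n k : ℕ} (hkn : k < n) (u : Fin n → ℝ) (y : Fin n) :
    L3 n k u y = (1 / (k : ℝ)) * ∑ i ∈ Finset.Icc 1 k, nthLarge (hinge u y) i := by
  unfold L3
  congr 1
  refine Finset.sum_congr rfl fun i hi => ?_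
  obtain ⟨hi1, hik⟩ := Finset.mem_Icc.1 hi
  exact (nthLarge_comp (u - Pi.single y 1 : Fin n → ℝ) (φ := fun x => max 0 (1 - u y + x))
    (fun a b hab => max_le_max_left 0 (by linarith)) hi1 (by omega)).symm

theorem L3_le_of_hinge_le {n k : ℕ} (hkn : k < n) {u v : Fin n → ℝ} {y : Fin n}
    (h : ∀ j, hinge u y j ≤ hinge v y j) : L3 n k u y ≤ L3 n k v y := by
  rw [L3_eq_hinge hkn, L3_eq_hinge hkn]
  refine mul_le_mul_of_nonneg_left (Finset.sum_le_sum fun i hi => ?_) (by positivity)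
  obtain ⟨hi1, hik⟩ := Finset.mem_Icc.1 hi
  exact nthLarge_mono h hi1 (by omega)

theorem continuous_nthLarge {n j : ℕ} (hj : 1 ≤ j) (hjn : j ≤ n) :
    Continuous fun v : Fin n → ℝ => nthLarge v j := by
  refine (LipschitzWith.of_le_add fun v w => ?_).continuous
  rw [← nthLarge_comp w (φ := fun x => x + dist v w) (fun a b hab => by simpa using hab) hj hjn]
  refine nthLarge_mono (fun i => ?_) hj hjn
  have h1 := dist_le_pi_dist v w i
  have h2 := le_abs_self (v i - w i)
  rw [Real.dist_eq] at h1
  linarith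

theorem continuous_L3 {n k : ℕ} (hkn : k < n) (y : Fin n) :
    Continuous fun u : Fin n → ℝ => L3 n k u y := by
  simp only [L3_eq_hinge hkn]
  refine continuous_const.mul (continuous_finsetSum _ fun i hi => ?_)
  obtain ⟨hi1, hik⟩ := Finset.mem_Icc.1 hi
  refine (continuous_nthLarge hi1 (by omega)).comp (continuous_pi fun j => ?_)
  unfold hinge
  simp only [Pi.sub_apply]
  fun_prop

/-- Compressing all gaps of length greater than one between the entries of `v` gives a vector
with entries in `[0, n]` and no larger hinge terms. -/
theorem exists_bounded_hinge_le {n : ℕ} (v : Fin n → ℝ) :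
    ∃ w : Fin n → ℝ, w ∈ Set.Icc (0 : Fin n → ℝ) (fun _ => (n : ℝ)) ∧
      ∀ y j, hinge w y j ≤ hinge v y j := by
  set U : Set ℝ := ⋃ j, Set.Ico (v j) (v j + 1) with hU
  have hUm : MeasurableSet U := MeasurableSet.iUnion fun _ => measurableSet_Ico
  have hUle : MeasureTheory.volume U ≤ n := by
    refine (MeasureTheory.measure_iUnion_fintype_le _ _).trans ?_
    simp [Real.volume_Ico]
  have hUfin : MeasureTheory.volume U ≠ ⊤ := ne_top_of_le_ne_top (by simp) hUle
  set f : ℝ → ℝ := fun x => MeasureTheory.volume.real (U ∩ Set.Iio x) with hf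
  have hfin : ∀ x, MeasureTheory.volume (U ∩ Set.Iio x) ≠ ⊤ := fun x =>
    ne_top_of_le_ne_top hUfin (MeasureTheory.measure_mono Set.inter_subset_left)
  have hdiff : ∀ a b, a ≤ b → f b = f a + MeasureTheory.volume.real (U ∩ Set.Ico a b) := by
    intro a b hab
    have hsplit : U ∩ Set.Iio b = (U ∩ Set.Iio a) ∪ (U ∩ Set.Ico a b) := by
      rw [← Set.inter_union_distrib_left, Set.Iio_union_Ico_eq_Iio hab]
    have hdisj : Disjoint (U ∩ Set.Iio a) (U ∩ Set.Ico a b) := by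
      refine Set.disjoint_left.2 fun x hx hx' => ?_
      exact absurd hx.2 (not_lt.2 hx'.2.1)
    simp only [hf]
    rw [hsplit, MeasureTheory.measureReal_union hdisj (hUm.inter measurableSet_Ico) (hfin a)
      (ne_top_of_le_ne_top hUfin (MeasureTheory.measure_mono Set.inter_subset_left))]
  have hub : ∀ a b, a ≤ b → f b - f a ≤ b - a := by
    intro a b hab
    have h1 : MeasureTheory.volume.real (U ∩ Set.Ico a b) ≤
        MeasureTheory.volume.real (Set.Ico a b) :=
      MeasureTheory.measureReal_mono Set.inter_subset_right (by simp)
    rw [Real.volume_real_Ico_of_le hab] at h1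
    linarith [hdiff a b hab]
  have hlb : ∀ j b, v j ≤ b → min 1 (b - v j) ≤ f b - f (v j) := by
    intro j b hab
    have h1 : MeasureTheory.volume.real (Set.Ico (v j) (min (v j + 1) b)) ≤
        MeasureTheory.volume.real (U ∩ Set.Ico (v j) b) := by
      refine MeasureTheory.measureReal_mono (fun x hx => ⟨?_, hx.1, ?_⟩)
        (ne_top_of_le_ne_top hUfin (MeasureTheory.measure_mono Set.inter_subset_left))
      · exact Set.mem_iUnion.2 ⟨j, hx.1, hx.2.trans_le (min_le_left _ _)⟩
      · exact hx.2.trans_le (min_le_right _ _)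
    rw [Real.volume_real_Ico_of_le (le_min (by linarith) hab)] at h1
    have h2 : min (v j + 1) b = v j + min 1 (b - v j) := by
      rw [← min_add_add_left]
      congr 1
      ring
    linarith [hdiff (v j) b hab]
  refine ⟨fun i => f (v i), ⟨fun i => MeasureTheory.measureReal_nonneg, fun i => ?_⟩, ?_⟩
  · refine ENNReal.toReal_le_of_le_ofReal (by positivity) ?_
    rw [ENNReal.ofReal_natCast]
    exact (MeasureTheory.measure_mono Set.inter_subset_left).trans hUle
  · intro y j
    unfold hinge
    simp only [Pi.sub_apply]
    by_cases hjy : j = y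
    · subst hjy
      simp
    simp only [Pi.single_eq_of_ne hjy, sub_zero]
    rcases le_total (v y) (v j) with h | h
    · exact max_le_max_left 0 (by linarith [hub _ _ h])
    · have h1 := hlb j (v y) h
      rcases le_total 1 (v y - v j) with h2 | h2
      · rw [min_eq_left h2] at h1
        exact max_le (le_max_left _ _) (le_trans (by linarith) (le_max_left _ _))
      · rw [min_eq_right h2] at h1
        exact max_le_max_left 0 (by linarith)

theorem L3_sub_const {n k : ℕ} (hkn : k < n) (u : Fin n → ℝ) (c : ℝ) (y : Fin n) :
    L3 n k (fun i => u i - c) y = L3 n k u y := by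
  have h : hinge (fun i => u i - c) y = hinge u y := by
    funext j
    simp only [hinge, Pi.sub_apply]
    congr 1
    ring
  rw [L3_eq_hinge hkn, L3_eq_hinge hkn, h]

theorem card_pos_le_of_nthLarge_eq_zero {n k : ℕ} (hkn : k < n) {u : Fin n → ℝ}
    (hu : nthLarge u (k + 1) = 0) : (Finset.univ.filter fun i => 0 < u i).card ≤ k := by
  by_contra! hlt
  obtain ⟨m, hm, hmin⟩ := Finset.exists_min_image (Finset.univ.filter fun i => 0 < u i) u
    (Finset.card_pos.1 (by omega))
  have hle : u m ≤ nthLarge u (k + 1) := by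
    refine (le_nthLarge_iff u (by omega) hkn _).2 (Nat.succ_le_of_lt hlt |>.trans ?_)
    exact Finset.card_le_card fun i hi => by simpa using hmin i hi
  have := (Finset.mem_filter.1 hm).2
  linarith

theorem exists_sparse_L3_le {n k : ℕ} (hkn : k < n) (v : Fin n → ℝ) :
    ∃ u : Fin n → ℝ,
      ((∀ i, 0 ≤ u i) ∧ ∃ T : Finset (Fin n), T.card ≤ k ∧ ∀ i ∉ T, u i = 0) ∧
      ∀ y, L3 n k u y ≤ L3 n k v y := by
  set c := nthLarge v (k + 1) with hc
  set w : Fin n → ℝ := fun i => v i - c with hw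
  have hw0 : nthLarge w (k + 1) = 0 := by
    rw [hw, nthLarge_comp v (φ := fun x => x - c) (fun a b hab => by simpa using hab)
      (by omega) hkn]
    simp [hc]
  refine ⟨fun i => max (w i) 0, ⟨fun i => le_max_right _ _, _,
    card_pos_le_of_nthLarge_eq_zero hkn hw0, fun i hi => ?_⟩, fun y => ?_⟩
  · exact max_eq_right (by simpa using hi)
  · exact (L3_posPart_le hkn hw0 y).trans_eq (L3_sub_const hkn v c y)

theorem stmt12 (n k : ℕ) (hk : 1 ≤ k) (hkn : k < n) :
    (∀ u : Fin n → ℝ, nthLarge u (k + 1) = 0 →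
      ∀ y : Fin n, L3 n k (fun i => max (u i) 0) y ≤ L3 n k u y) ∧
    (∀ p ∈ simplex n, ∃ u : Fin n → ℝ,
      ((∀ i, 0 ≤ u i) ∧ ∃ T : Finset (Fin n), T.card ≤ k ∧ ∀ i ∉ T, u i = 0) ∧
      ∀ v : Fin n → ℝ, ∑ y, p y * L3 n k u y ≤ ∑ y, p y * L3 n k v y) := by
  refine ⟨fun u hu y => L3_posPart_le hkn hu y, fun p hp => ?_⟩
  have hcont : Continuous fun u : Fin n → ℝ => ∑ y, p y * L3 n k u y :=
    continuous_finsetSum _ fun y _ => continuous_const.mul (continuous_L3 hkn y)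
  obtain ⟨v₀, -, hmin⟩ := (isCompact_Icc (a := (0 : Fin n → ℝ))
    (b := fun _ => (n : ℝ))).exists_isMinOn (Set.nonempty_Icc.2 fun _ => by simp) hcont.continuousOn
  obtain ⟨u, hu, hle⟩ := exists_sparse_L3_le hkn v₀
  have hrisk : ∀ {a b : Fin n → ℝ}, (∀ y, L3 n k a y ≤ L3 n k b y) →
      ∑ y, p y * L3 n k a y ≤ ∑ y, p y * L3 n k b y := fun h =>
    Finset.sum_le_sum fun y _ => mul_le_mul_of_nonneg_left (h y) (hp.1 y)
  refine ⟨u, hu, fun v => ?_⟩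
  obtain ⟨w, hw, hwv⟩ := exists_bounded_hinge_le v
  exact (hrisk hle).trans ((hmin hw).trans (hrisk fun y => L3_le_of_hinge_le hkn (hwv y)))
end

section
/- Let u ∈ ℝ^n have its (k+1)-th largest entry equal to 0, and let u' ∈ ℝ^n be defined coordinatewise by u'_i = max(u_i, 0). Then L^(4)(u, y) ≥ L^(4)(u', y) for every y ∈ Y. (Hence the set R_low = {u ∈ ℝ^n : u_i ≥ 0 for all i and u has at most k nonzero entries} is representative for L^(4).) -/
open scoped NNReal

lemma powersetCard_erase_nonempty {n k : ℕ} (hkn : k < n) (y : Fin n) :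
    ((Finset.univ.erase y).powersetCard k).Nonempty := by
  rw [Finset.powersetCard_nonempty, Finset.card_erase_of_mem (Finset.mem_univ y),
    Finset.card_univ, Fintype.card_fin]
  omega

lemma sigmaExcl_le {n k : ℕ} (hkn : k < n) (u : Fin n → ℝ) (y : Fin n) {B : ℝ}
    (h : ∀ S : Finset (Fin n), y ∉ S → S.card = k → ∑ i ∈ S, u i ≤ B) :
    sigmaExcl n k u y ≤ B := by
  rw [sigmaExcl, dif_pos (powersetCard_erase_nonempty hkn y)]
  refine Finset.sup'_le _ _ fun S hS => ?_
  rw [Finset.mem_powersetCard, Finset.subset_erase] at hS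
  exact h S hS.1.2 hS.2

lemma le_sigmaExcl {n k : ℕ} (u : Fin n → ℝ) {y : Fin n} {S : Finset (Fin n)}
    (hy : y ∉ S) (hS : S.card = k) : ∑ i ∈ S, u i ≤ sigmaExcl n k u y := by
  have hmem : S ∈ (Finset.univ.erase y).powersetCard k :=
    Finset.mem_powersetCard.2 ⟨Finset.subset_erase.2 ⟨Finset.subset_univ _, hy⟩, hS⟩
  rw [sigmaExcl, dif_pos ⟨S, hmem⟩]
  exact Finset.le_sup' (fun S => ∑ i ∈ S, u i) hmem

lemma sigmaExcl_mono {n k : ℕ} (hkn : k < n) {u v : Fin n → ℝ} (h : ∀ i, u i ≤ v i)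
    (y : Fin n) : sigmaExcl n k u y ≤ sigmaExcl n k v y :=
  sigmaExcl_le hkn u y fun _ hy hS =>
    (Finset.sum_le_sum fun i _ => h i).trans (le_sigmaExcl v hy hS)

lemma continuous_L4 (n k : ℕ) (y : Fin n) : Continuous fun u => L4 n k u y := by
  have hσ : Continuous fun u => sigmaExcl n k u y := by
    unfold sigmaExcl
    split_ifs with h
    · exact Continuous.finset_sup'_apply h fun S _ => by fun_prop
    · exact continuous_const
  unfold L4
  fun_prop

lemma L4_sub_const {n k : ℕ} (hk : 1 ≤ k) (hkn : k < n) (u : Fin n → ℝ) (c : ℝ) (y : Fin n) :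
    L4 n k (fun i => u i - c) y ≤ L4 n k u y := by
  have hk0 : (0 : ℝ) < k := by exact_mod_cast hk
  have hσ : sigmaExcl n k (fun i => u i - c) y ≤ sigmaExcl n k u y - k * c := by
    refine sigmaExcl_le hkn _ y fun S hy hS => ?_
    rw [Finset.sum_sub_distrib, Finset.sum_const, hS, nsmul_eq_mul]
    linarith [le_sigmaExcl u hy hS]
  refine max_le_max le_rfl ?_
  have := mul_le_mul_of_nonneg_left hσ (one_div_pos.2 hk0).le
  have hc : 1 / (k : ℝ) * (sigmaExcl n k u y - k * c) = 1 / k * sigmaExcl n k u y - c := by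
    field_simp
  linarith

lemma L4_posPart_le {n k : ℕ} (hkn : k < n) {u : Fin n → ℝ} {P : Finset (Fin n)}
    (hP : k < P.card) (hu : ∀ i ∈ P, 0 ≤ u i) (y : Fin n) :
    L4 n k (fun i => max (u i) 0) y ≤ L4 n k u y := by
  have hσ : sigmaExcl n k (fun i => max (u i) 0) y ≤ sigmaExcl n k u y := by
    refine sigmaExcl_le hkn _ y fun S hy hS => ?_
    set N : Finset (Fin n) := (Finset.univ.filter fun i => 0 ≤ u i).erase y with hN
    have hNcard : k ≤ N.card := by
      have h1 : (P.erase y).card ≤ N.card := Finset.card_le_card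
        (Finset.erase_subset_erase _ fun i hi => by simpa using hu i hi)
      have h2 := Finset.pred_card_le_card_erase (s := P) (a := y)
      omega
    have hsub : S.filter (fun i => 0 ≤ u i) ⊆ N := by
      intro i hi
      rw [Finset.mem_filter] at hi
      simp only [hN, Finset.mem_erase, Finset.mem_filter, Finset.mem_univ, true_and]
      exact ⟨fun h => hy (h ▸ hi.1), hi.2⟩
    obtain ⟨S', hS1, hS2, hS3⟩ := Finset.exists_subsuperset_card_eq hsub
      ((Finset.card_filter_le _ _).trans hS.le) hNcard
    have hN0 : ∀ i ∈ S', 0 ≤ u i := fun i hi => by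
      have := hS2 hi
      simp only [hN, Finset.mem_erase, Finset.mem_filter] at this
      exact this.2.2
    have hyS' : y ∉ S' := fun h => by simpa [hN] using hS2 h
    calc ∑ i ∈ S, max (u i) 0
        = ∑ i ∈ S.filter (fun i => 0 ≤ u i), u i := by
          rw [Finset.sum_filter]
          refine Finset.sum_congr rfl fun i _ => ?_
          split_ifs with h
          · exact max_eq_left h
          · exact max_eq_right (not_le.1 h).le
      _ ≤ ∑ i ∈ S', u i := Finset.sum_le_sum_of_subset_of_nonneg hS1 fun i hi _ => hN0 i hi
      _ ≤ sigmaExcl n k u y := le_sigmaExcl u hyS' hS3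
  have := mul_le_mul_of_nonneg_left hσ (by positivity : (0 : ℝ) ≤ 1 / k)
  exact max_le_max le_rfl (by linarith [le_max_left (u y) 0])

lemma L4_min_le {n k : ℕ} (hk : 1 ≤ k) (hkn : k < n) {u : Fin n → ℝ} {T : Finset (Fin n)}
    (hT : T.card ≤ k) (hu : ∀ i ∉ T, u i = 0) (y : Fin n) :
    L4 n k (fun i => min (u i) k) y ≤ L4 n k u y := by
  have hk0 : (0 : ℝ) < k := by exact_mod_cast hk
  rcases le_or_gt (u y) k with hy | hy
  · have hσ : sigmaExcl n k (fun i => min (u i) k) y ≤ sigmaExcl n k u y :=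
      sigmaExcl_mono hkn (fun i => min_le_left _ _) y
    have := mul_le_mul_of_nonneg_left hσ (one_div_pos.2 hk0).le
    refine max_le_max le_rfl ?_
    beta_reduce
    rw [min_eq_left hy]
    linarith
  · have hyT : y ∈ T := by
      by_contra h
      rw [hu y h] at hy
      linarith
    have hσ : sigmaExcl n k (fun i => min (u i) k) y ≤ (k - 1) * k := by
      refine sigmaExcl_le hkn _ y fun S hyS _ => ?_
      calc ∑ i ∈ S, min (u i) (k : ℝ)
          ≤ ∑ i ∈ S, if i ∈ T.erase y then (k : ℝ) else 0 := by
            refine Finset.sum_le_sum fun i hi => ?_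
            split_ifs with h
            · exact min_le_right _ _
            · have hiT : i ∉ T := fun h' =>
                h (Finset.mem_erase.2 ⟨fun e => hyS (e ▸ hi), h'⟩)
              exact (min_le_left _ _).trans (hu i hiT).le
        _ ≤ ∑ i, if i ∈ T.erase y then (k : ℝ) else 0 :=
            Finset.sum_le_sum_of_subset_of_nonneg (Finset.subset_univ _) fun i _ _ => by
              split_ifs <;> positivity
        _ = ((T.erase y).card : ℝ) * k := by
            rw [Finset.sum_ite_mem, Finset.univ_inter, Finset.sum_const, nsmul_eq_mul]
        _ ≤ (k - 1) * k := by
            refine mul_le_mul_of_nonneg_right ?_ hk0.le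
            have := Finset.card_erase_add_one hyT
            rw [le_sub_iff_add_le]
            exact_mod_cast this.le.trans hT
    have := mul_le_mul_of_nonneg_left hσ (one_div_pos.2 hk0).le
    have hc : 1 / (k : ℝ) * ((k - 1) * k) = k - 1 := by field_simp
    refine max_le (le_max_left _ _) (le_trans ?_ (le_max_left _ _))
    beta_reduce
    rw [min_eq_right hy.le]
    linarith

lemma exists_card_nthLarge_le {n k : ℕ} (hkn : k < n) (u : Fin n → ℝ) :
    ∃ P : Finset (Fin n), k < P.card ∧ ∀ i ∈ P, nthLarge u (k + 1) ≤ u i := by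
  have h : n - (k + 1) < n := by omega
  refine ⟨(Finset.Ici ⟨n - (k + 1), h⟩).map (Tuple.sort u).toEmbedding, ?_, fun i hi => ?_⟩
  · rw [Finset.card_map, Fin.card_Ici]
    simp only
    omega
  · obtain ⟨j, hj, rfl⟩ := Finset.mem_map.1 hi
    rw [nthLarge, dif_pos h]
    exact Tuple.monotone_sort u (Finset.mem_Ici.1 hj)

lemma exists_card_le_nthLarge {n k : ℕ} (hkn : k < n) (u : Fin n → ℝ) :
    ∃ T : Finset (Fin n), T.card ≤ k ∧ ∀ i ∉ T, u i ≤ nthLarge u (k + 1) := by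
  have h : n - (k + 1) < n := by omega
  refine ⟨(Finset.Ioi ⟨n - (k + 1), h⟩).map (Tuple.sort u).toEmbedding, ?_, fun i hi => ?_⟩
  · rw [Finset.card_map, Fin.card_Ioi]
    simp only
    omega
  · obtain ⟨j, rfl⟩ := (Tuple.sort u).surjective i
    rw [nthLarge, dif_pos h]
    refine Tuple.monotone_sort u (not_lt.1 fun hj => hi ?_)
    exact Finset.mem_map.2 ⟨j, Finset.mem_Ioi.2 hj, rfl⟩

/-- Vectors with entries in `[0, k]` and at most `k` nonzero entries. -/
def boundedSparse (n k : ℕ) : Set (Fin n → ℝ) :=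
  {u | (∀ i, u i ∈ Set.Icc (0 : ℝ) k) ∧ ∃ T : Finset (Fin n), T.card ≤ k ∧ ∀ i ∉ T, u i = 0}

lemma isCompact_boundedSparse (n k : ℕ) : IsCompact (boundedSparse n k) := by
  have hbox : IsCompact (Set.univ.pi fun _ : Fin n => Set.Icc (0 : ℝ) k) :=
    isCompact_univ_pi fun _ => isCompact_Icc
  have hclosed : IsClosed (⋃ T ∈ {T : Finset (Fin n) | T.card ≤ k},
      {u : Fin n → ℝ | ∀ i ∉ T, u i = 0}) := by
    refine (Set.toFinite _).isClosed_biUnion fun T _ => ?_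
    simp only [Set.ofPred_forall]
    exact isClosed_iInter fun i => isClosed_iInter fun _ =>
      isClosed_eq (continuous_apply i) continuous_const
  convert hbox.inter_right hclosed using 1
  ext u
  simp [boundedSparse, Pi.le_def, forall_and]

lemma exists_boundedSparse_L4_le {n k : ℕ} (hk : 1 ≤ k) (hkn : k < n) (v : Fin n → ℝ) :
    ∃ u ∈ boundedSparse n k, ∀ y, L4 n k u y ≤ L4 n k v y := by
  set c := nthLarge v (k + 1)
  obtain ⟨P, hP, hvP⟩ := exists_card_nthLarge_le hkn v
  obtain ⟨T, hT, hvT⟩ := exists_card_le_nthLarge hkn v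
  have hsupp : ∀ i ∉ T, max (v i - c) 0 = 0 := fun i hi =>
    max_eq_right (sub_nonpos.2 (hvT i hi))
  refine ⟨fun i => min (max (v i - c) 0) k,
    ⟨fun i => ⟨le_min (le_max_right _ _) k.cast_nonneg, min_le_right _ _⟩, T, hT,
      fun i hi => ?_⟩, fun y => ?_⟩
  · simp only [hsupp i hi]
    exact min_eq_left k.cast_nonneg
  · exact ((L4_min_le hk hkn hT hsupp y).trans
      (L4_posPart_le hkn hP (fun i hi => sub_nonneg.2 (hvP i hi)) y)).trans
      (L4_sub_const hk hkn v c y)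

theorem stmt14 (n k : ℕ) (hk : 1 ≤ k) (hkn : k < n) :
    (∀ u : Fin n → ℝ, nthLarge u (k + 1) = 0 →
      ∀ y : Fin n, L4 n k (fun i => max (u i) 0) y ≤ L4 n k u y) ∧
    (∀ p ∈ simplex n, ∃ u : Fin n → ℝ,
      ((∀ i, 0 ≤ u i) ∧ ∃ T : Finset (Fin n), T.card ≤ k ∧ ∀ i ∉ T, u i = 0) ∧
      ∀ v : Fin n → ℝ, ∑ y, p y * L4 n k u y ≤ ∑ y, p y * L4 n k v y) := by
  refine ⟨fun u hu y => ?_, fun p hp => ?_⟩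
  · obtain ⟨P, hP, hPu⟩ := exists_card_nthLarge_le hkn u
    exact L4_posPart_le hkn hP (hu ▸ hPu) y
  · have hcont : Continuous fun u => ∑ y, p y * L4 n k u y :=
      continuous_finsetSum _ fun y _ => continuous_const.mul (continuous_L4 n k y)
    obtain ⟨u₀, hu₀, -⟩ := exists_boundedSparse_L4_le hk hkn 0
    obtain ⟨u, hu, hmin⟩ :=
      (isCompact_boundedSparse n k).exists_isMinOn ⟨u₀, hu₀⟩ hcont.continuousOn
    refine ⟨u, ⟨fun i => (hu.1 i).1, hu.2⟩, fun v => ?_⟩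
    obtain ⟨w, hw, hwv⟩ := exists_boundedSparse_L4_le hk hkn v
    exact (hmin hw).trans
      (Finset.sum_le_sum fun y _ => mul_le_mul_of_nonneg_left (hwv y) (hp.1 y))
end
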